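/- Let Q be a quiver of type A_n with n ≥ 2, and let λ: I → ℂ be a generic weight with ν(λ) = -λ. Then the deformed preprojective algebra A_λ = ℂQ̄ / (Σ_{a∈Q}[a,a*] - Σ_i λ_i e_i) is semisimple, with simple modules of dimensions n, n-2, n-4, …. -/

import Mathlib

open scoped BigOperators

/-- The data of a quiver `Q` (with vertex set `I` and arrow set `E`), to be assumed of
ADE type via `IsADE` below, together with the combinatorial invariants of the associated
root system: the exponents `m 0 ≤ m 1 ≤ ⋯ ≤ m (r-1)` (only the values `m i` for `i < r`
are relevant), the Coxeter number `h`, and the involution `ν` of the vertex set induced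
by the longest element `w₀` of the Weyl group (`w₀ (α_i) = -α_{ν i}`). -/
structure ADEQuiver where
  I : Type
  [fintypeI : Fintype I]
  [decEqI : DecidableEq I]
  E : Type
  [fintypeE : Fintype E]
  src : E → I
  tgt : E → I
  m : ℕ → ℕ
  h : ℕ
  nu : I → I

attribute [instance] ADEQuiver.fintypeI ADEQuiver.decEqI ADEQuiver.fintypeE

namespace ADEQuiver

variable (Q : ADEQuiver)

/-- the number of vertices of `Q` -/
def r : ℕ := Fintype.card Q.I

/-- The adjacency matrix of the double quiver `Q̄` (equivalently, of the underlying
graph of `Q`): `C i j` is the number of arrows from `i` to `j` in `Q̄`. -/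
def C : Matrix Q.I Q.I ℤ := fun i j =>
  ((Finset.univ.filter fun e => Q.src e = i ∧ Q.tgt e = j).card : ℤ) +
  ((Finset.univ.filter fun e => Q.src e = j ∧ Q.tgt e = i).card : ℤ)

/-- `Q` is a quiver of ADE type: its underlying graph is connected and the symmetrized
Cartan matrix `2·1 - C` is positive definite.  (A connected graph is a simply-laced
Dynkin diagram, i.e. of type Aₙ, Dₙ, E₆, E₇ or E₈, if and only if `2·1 - C ≻ 0`.) -/
def IsADE : Prop :=
  (∀ i j : Q.I, Relation.ReflTransGen
      (fun a b => ∃ e, (Q.src e = a ∧ Q.tgt e = b) ∨ (Q.src e = b ∧ Q.tgt e = a)) i j) ∧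
  ((2 : ℝ) • (1 : Matrix Q.I Q.I ℝ) - Q.C.map (Int.cast : ℤ → ℝ)).PosDef

/-- `m 0 ≤ ⋯ ≤ m (r - 1)` are the exponents of the root system attached to `Q`, and `h`
is its Coxeter number: the exponents are increasing positive integers with
`h = m_r + 1`, and the eigenvalues of the adjacency matrix `C` are `2 cos (m_i π / h)`
(expressed below as a factorization of the characteristic polynomial of `C` over `ℝ`). -/
def ExponentsSpec : Prop :=
  (Q.C.map (Int.cast : ℤ → ℝ)).charpoly =
      ∏ i ∈ Finset.range Q.r,
        (Polynomial.X - Polynomial.C (2 * Real.cos (Q.m i * Real.pi / Q.h))) ∧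
  (∀ i j : ℕ, i ≤ j → j < Q.r → Q.m i ≤ Q.m j) ∧
  (∀ i : ℕ, i < Q.r → 1 ≤ Q.m i) ∧
  1 ≤ Q.r ∧ Q.h = Q.m (Q.r - 1) + 1

/-- `ν` is the involution of `I` with `w₀ (α_i) = -α_{ν i}`: among the involutive
automorphisms of the underlying graph it is characterized by the fact that the number
of vertices not fixed by it equals `2·#{i : m_i even}`. -/
def NuSpec : Prop :=
  Function.Involutive Q.nu ∧
  (∀ i j, Q.C (Q.nu i) (Q.nu j) = Q.C i j) ∧
  (Finset.univ.filter fun i => Q.nu i ≠ i).card =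
    2 * ((Finset.range Q.r).filter fun i => Even (Q.m i)).card

/-- `r₋ = dim ker (P + 1)`: half the number of vertices not fixed by `ν`. -/
def rMinus : ℕ := (Finset.univ.filter fun i => Q.nu i ≠ i).card / 2

/-- `r₊ = dim ker (P - 1) = r - r₋`. -/
def rPlus : ℕ := Q.r - Q.rMinus

/-- The dimension of the degree-`d` homogeneous component of the graded vector space `U`
with Hilbert series `∑_{i : m_i < h/2} t^{2 m_i}`. -/
def uDim (d : ℤ) : ℕ :=
  ((Finset.range Q.r).filter fun i => 2 * Q.m i < Q.h ∧ (2 * Q.m i : ℤ) = d).card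

/-- `dim Y = r₊ - r₋ - #{i : m_i = h/2}` (`Y` sits in degree 0). -/
def yDim : ℕ :=
  Q.rPlus - Q.rMinus - ((Finset.range Q.r).filter fun i => 2 * Q.m i = Q.h).card

/-- `dim L = r₊ - r₋`, where `L = ⟨e_i | ν i = i⟩` (`L` sits in degree 0). -/
def lDim : ℕ := Q.rPlus - Q.rMinus

end ADEQuiver

namespace ADEQuiver

variable (Q : ADEQuiver)

/-- The generators of the path algebra `ℂQ̄` of the double quiver: the trivial paths
`e_i` (`Sum.inl i`) and the arrows of `Q̄ = Q ∪ Q*` (`Sum.inr (Sum.inl a)` for `a ∈ Q`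
and `Sum.inr (Sum.inr a)` for `a* ∈ Q*`). -/
abbrev Gen := Q.I ⊕ (Q.E ⊕ Q.E)

/-- source of an arrow of the double quiver `Q̄` -/
def dsrc : Q.E ⊕ Q.E → Q.I := Sum.elim Q.src Q.tgt

/-- target of an arrow of the double quiver `Q̄` -/
def dtgt : Q.E ⊕ Q.E → Q.I := Sum.elim Q.tgt Q.src

/-- The defining relations of the deformed preprojective algebra
`A_λ = ℂQ̄ / (∑_{a ∈ Q} [a, a*] - ∑_i λ_i e_i)`: the presentation of the path algebra
`ℂQ̄` of the double quiver (the `e_i` are orthogonal idempotents summing to `1` and the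
arrows are composable according to their endpoints), together with the deformed
preprojective relation `∑_{a ∈ Q} [a, a*] = ∑_i λ_i e_i`.  For `λ = 0` this presents
the preprojective algebra `A = Π_Q` itself. -/
inductive PathRel (lam : Q.I → ℂ) :
    FreeAlgebra ℂ Q.Gen → FreeAlgebra ℂ Q.Gen → Prop
  | vertex_mul (i j : Q.I) :
      PathRel lam (FreeAlgebra.ι ℂ (Sum.inl i : Q.Gen) * FreeAlgebra.ι ℂ (Sum.inl j))
        (if i = j then FreeAlgebra.ι ℂ (Sum.inl i : Q.Gen) else 0)
  | sum_vertices :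
      PathRel lam (∑ i : Q.I, FreeAlgebra.ι ℂ (Sum.inl i : Q.Gen)) 1
  | arr_src (x : Q.E ⊕ Q.E) :
      PathRel lam
        (FreeAlgebra.ι ℂ (Sum.inr x : Q.Gen) * FreeAlgebra.ι ℂ (Sum.inl (Q.dsrc x)))
        (FreeAlgebra.ι ℂ (Sum.inr x : Q.Gen))
  | arr_tgt (x : Q.E ⊕ Q.E) :
      PathRel lam
        (FreeAlgebra.ι ℂ (Sum.inl (Q.dtgt x) : Q.Gen) * FreeAlgebra.ι ℂ (Sum.inr x))
        (FreeAlgebra.ι ℂ (Sum.inr x : Q.Gen))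
  | preproj :
      PathRel lam
        (∑ a : Q.E,
          (FreeAlgebra.ι ℂ (Sum.inr (Sum.inl a) : Q.Gen) *
              FreeAlgebra.ι ℂ (Sum.inr (Sum.inr a)) -
            FreeAlgebra.ι ℂ (Sum.inr (Sum.inr a) : Q.Gen) *
              FreeAlgebra.ι ℂ (Sum.inr (Sum.inl a))))
        (∑ i : Q.I, lam i • FreeAlgebra.ι ℂ (Sum.inl i : Q.Gen))

/-- The deformed preprojective algebra `A_λ`; for `λ = 0` this is the preprojective
algebra `A = Π_Q`. -/
abbrev Deformed (lam : Q.I → ℂ) := RingQuot (Q.PathRel lam)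

/-- the images of the generators in `A_λ` -/
def gen (lam : Q.I → ℂ) (g : Q.Gen) : Q.Deformed lam :=
  RingQuot.mkAlgHom ℂ (Q.PathRel lam) (FreeAlgebra.ι ℂ g)

/-- the image in `A_λ` of a word in the generators -/
def wordVal (lam : Q.I → ℂ) (w : List Q.Gen) : Q.Deformed lam :=
  (w.map (Q.gen lam)).prod

/-- the number of arrow-letters of a word (its path length) -/
def arrowCount (w : List Q.Gen) : ℕ := w.countP fun g => g.isRight

/-- The filtration of `A_λ` by length of paths: `filt lam n` is spanned by the images
of the words containing at most `n` arrows. -/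
def filt (lam : Q.I → ℂ) (n : ℕ) : Submodule ℂ (Q.Deformed lam) :=
  Submodule.span ℂ {x | ∃ w : List Q.Gen, Q.arrowCount w ≤ n ∧ x = Q.wordVal lam w}

end ADEQuiver

open ADEQuiver


/-- The quiver of type `Aₙ`: vertices `1, …, n` (here `Fin n`), with an arrow
`k → k+1` for `k = 1, …, n-1`; the exponents are `1, 2, …, n`, the Coxeter number is
`h = n + 1`, and the involution `ν` induced by the longest Weyl group element is
`i ↦ n + 1 - i` (the nontrivial diagram involution for `n ≥ 2`). -/
def typeA (n : ℕ) : ADEQuiver where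
  I := Fin n
  E := Fin (n - 1)
  src := fun k => ⟨k.1, by have := k.2; omega⟩
  tgt := fun k => ⟨k.1 + 1, by have := k.2; omega⟩
  m := fun i => i + 1
  h := n + 1
  nu := fun i => ⟨n - 1 - i.1, by have := i.2; omega⟩

open ADEQuiver


structure ARel {A : Type*} [Ring A] [Algebra ℂ A] (n : ℕ) (lam : ℕ → ℂ) (e a b : ℕ → A) :
    Prop where
  ee : ∀ i j, e i * e j = if i = j then e i else 0
  sum : ∑ i ∈ Finset.range n, e i = 1
  e0 : ∀ i, n ≤ i → e i = 0
  a0 : ∀ i, n ≤ i + 1 → a i = 0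
  b0 : ∀ i, n ≤ i + 1 → b i = 0
  ae : ∀ i, a i * e i = a i
  ea : ∀ i, e (i + 1) * a i = a i
  be : ∀ i, b i * e (i + 1) = b i
  eb : ∀ i, e i * b i = b i
  r0 : -(b 0 * a 0) = lam 0 • e 0
  rs : ∀ i, a i * b i - b (i + 1) * a (i + 1) = lam (i + 1) • e (i + 1)

def tt (lam : ℕ → ℂ) (k : ℕ) : ℂ := ∑ j ∈ Finset.range k, lam j

def zz {A : Type*} [Ring A] [Algebra ℂ A] (n : ℕ) (lam : ℕ → ℂ) (e a b : ℕ → A) : A :=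
  ∑ i ∈ Finset.range n, (b i * a i + tt lam (i + 1) • e i)

def UU {A : Type*} [Ring A] (e a : ℕ → A) (k : ℕ) : ℕ → A
  | 0 => e k
  | d + 1 => a (k + d) * UU e a k d

def WW {A : Type*} [Ring A] (e b : ℕ → A) (k : ℕ) : ℕ → A
  | 0 => e k
  | d + 1 => WW e b k d * b (k + d)

def cc (lam : ℕ → ℂ) (k d : ℕ) : ℂ :=
  ∏ l ∈ Finset.range d, (tt lam k - tt lam (k + l + 1))

theorem commute_aeval_of {A : Type*} [Ring A] [Algebra ℂ A] {z x : A} (h : z * x = x * z)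
    (p : Polynomial ℂ) : Polynomial.aeval z p * x = x * Polynomial.aeval z p := by
  induction p using Polynomial.induction_on' with
  | add p q hp hq => rw [map_add, add_mul, mul_add, hp, hq]
  | monomial k c =>
    rw [Polynomial.aeval_monomial, ← Algebra.smul_def, smul_mul_assoc, mul_smul_comm]
    congr 1
    exact ((show Commute z x from h).pow_left k).eq

namespace ARel

variable {A : Type*} [Ring A] [Algebra ℂ A] {n : ℕ} {lam : ℕ → ℂ} {e a b : ℕ → A}

theorem e_ne (H : ARel n lam e a b) {i j : ℕ} (h : i ≠ j) : e i * e j = 0 := by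
  rw [H.ee, if_neg h]

theorem e_self (H : ARel n lam e a b) (i : ℕ) : e i * e i = e i := by
  rw [H.ee, if_pos rfl]

theorem ae_ne (H : ARel n lam e a b) {i j : ℕ} (h : i ≠ j) : a i * e j = 0 := by
  rw [← H.ae, mul_assoc, H.e_ne h, mul_zero]

theorem eb_ne (H : ARel n lam e a b) {i j : ℕ} (h : j ≠ i) : e j * b i = 0 := by
  rw [← H.eb, ← mul_assoc, H.e_ne h, zero_mul]

theorem be_ne (H : ARel n lam e a b) {i j : ℕ} (h : i + 1 ≠ j) : b i * e j = 0 := by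
  rw [← H.be, mul_assoc, H.e_ne h, mul_zero]

theorem ea_ne (H : ARel n lam e a b) {i j : ℕ} (h : j ≠ i + 1) : e j * a i = 0 := by
  rw [← H.ea, ← mul_assoc, H.e_ne h, zero_mul]

theorem z_e (H : ARel n lam e a b) (i : ℕ) :
    zz n lam e a b * e i = b i * a i + tt lam (i + 1) • e i := by
  by_cases hi : n ≤ i
  · rw [H.e0 i hi, H.a0 i (by omega)]; simp
  · rw [zz, Finset.sum_mul, Finset.sum_eq_single i]
    · rw [add_mul, mul_assoc, H.ae, smul_mul_assoc, H.e_self]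
    · intro j _ hj
      rw [add_mul, mul_assoc, H.ae_ne hj, smul_mul_assoc, H.e_ne hj]; simp
    · intro h; simp at h; omega

theorem e_z (H : ARel n lam e a b) (i : ℕ) :
    e i * zz n lam e a b = b i * a i + tt lam (i + 1) • e i := by
  by_cases hi : n ≤ i
  · rw [H.e0 i hi, H.a0 i (by omega)]; simp
  · rw [zz, Finset.mul_sum, Finset.sum_eq_single i]
    · rw [mul_add, ← mul_assoc, H.eb, mul_smul_comm, H.e_self]
    · intro j _ hj
      rw [mul_add, ← mul_assoc, H.eb_ne hj.symm, mul_smul_comm, H.e_ne hj.symm]; simp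
    · intro h; simp at h; omega

theorem tt_succ (lam : ℕ → ℂ) (k : ℕ) : tt lam (k + 1) = tt lam k + lam k := by
  rw [tt, Finset.sum_range_succ, tt]

theorem z_e_zero (H : ARel n lam e a b) : zz n lam e a b * e 0 = 0 := by
  rw [H.z_e, tt_succ]
  have := H.r0
  simp [tt, ← this]

theorem ba_succ (H : ARel n lam e a b) (i : ℕ) :
    b (i + 1) * a (i + 1) + tt lam (i + 1 + 1) • e (i + 1)
      = a i * b i + tt lam (i + 1) • e (i + 1) := by
  have := H.rs i
  rw [tt_succ lam (i + 1), add_smul, ← this]; abel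

theorem z_e_succ (H : ARel n lam e a b) (i : ℕ) :
    zz n lam e a b * e (i + 1) = a i * b i + tt lam (i + 1) • e (i + 1) := by
  rw [H.z_e, H.ba_succ]

theorem e_succ_z (H : ARel n lam e a b) (i : ℕ) :
    e (i + 1) * zz n lam e a b = a i * b i + tt lam (i + 1) • e (i + 1) := by
  rw [H.e_z, H.ba_succ]

theorem z_comm_e (H : ARel n lam e a b) (i : ℕ) :
    zz n lam e a b * e i = e i * zz n lam e a b := by rw [H.z_e, H.e_z]

theorem z_comm_a (H : ARel n lam e a b) (i : ℕ) :
    zz n lam e a b * a i = a i * zz n lam e a b := by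
  conv_lhs => rw [← H.ea, ← mul_assoc, H.z_e_succ, add_mul, smul_mul_assoc, H.ea]
  conv_rhs => rw [← H.ae, mul_assoc, H.e_z, mul_add, mul_smul_comm, H.ae]
  rw [mul_assoc]

theorem z_comm_b (H : ARel n lam e a b) (i : ℕ) :
    zz n lam e a b * b i = b i * zz n lam e a b := by
  conv_lhs => rw [← H.eb, ← mul_assoc, H.z_e, add_mul, smul_mul_assoc, H.eb]
  conv_rhs => rw [← H.be, mul_assoc, H.e_succ_z, mul_add, mul_smul_comm, H.be]
  rw [mul_assoc]

open Polynomial in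
theorem nodal_succ (lam : ℕ → ℂ) (m : ℕ) : Lagrange.nodal (Finset.range (m + 1)) (tt lam) =
    Lagrange.nodal (Finset.range m) (tt lam) * (X - C (tt lam m)) := by
  rw [Lagrange.nodal, Finset.prod_range_succ, Lagrange.nodal]

open Polynomial in
theorem aeval_nodal_succ (lam : ℕ → ℂ) (m : ℕ) (z : A) :
    aeval z (Lagrange.nodal (Finset.range (m + 1)) (tt lam)) =
    aeval z (Lagrange.nodal (Finset.range m) (tt lam)) * (z - tt lam m • 1) := by
  rw [nodal_succ, map_mul, map_sub, aeval_X, aeval_C, Algebra.algebraMap_eq_smul_one]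

open Polynomial in
theorem nodal_e_low (H : ARel n lam e a b) (i : ℕ) :
    aeval (zz n lam e a b) (Lagrange.nodal (Finset.range (i + 1)) (tt lam)) * e i = 0 := by
  induction i with
  | zero =>
    rw [aeval_nodal_succ, mul_assoc, sub_mul, H.z_e_zero]; simp [tt]
  | succ i ih =>
    rw [aeval_nodal_succ, mul_assoc, sub_mul, H.z_e_succ, smul_mul_assoc, one_mul,
      add_sub_cancel_right, ← mul_assoc, commute_aeval_of (H.z_comm_a i), ← H.eb, ← mul_assoc,
      mul_assoc (a i), ih, mul_zero, zero_mul]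

open Polynomial in
theorem nodal_e_high (H : ARel n lam e a b) (hs : ∀ k, k ≤ n → tt lam (n - k) = tt lam k)
    (j : ℕ) (i : ℕ) (hij : i + j + 1 = n) :
    aeval (zz n lam e a b) (Lagrange.nodal (Finset.range (j + 1)) (tt lam)) * e i = 0 := by
  induction j generalizing i with
  | zero =>
    rw [aeval_nodal_succ, mul_assoc, sub_mul, H.z_e, H.a0 _ (by omega), ← hs 0 (by omega),
      show i + 1 = n - 0 by omega]; simp
  | succ j ih =>
    rw [aeval_nodal_succ, mul_assoc, sub_mul, H.z_e, smul_mul_assoc, one_mul,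
      ← hs (j+1) (by omega), show i + 1 = n - (j + 1) by omega,
      add_sub_cancel_right, ← mul_assoc, commute_aeval_of (H.z_comm_b i), ← H.ea, ← mul_assoc,
      mul_assoc (b i), ih (i+1) (by omega), mul_zero, zero_mul]

open Polynomial in
theorem nodal_le {m m' : ℕ} (h : m ≤ m') (z x : A)
    (h0 : aeval z (Lagrange.nodal (Finset.range m) (tt lam)) * x = 0) :
    aeval z (Lagrange.nodal (Finset.range m') (tt lam)) * x = 0 := by
  induction m', h using Nat.le_induction with
  | base => exact h0
  | succ m' _ ih =>
    rw [nodal_succ, mul_comm, map_mul, mul_assoc, ih, mul_zero]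

open Polynomial in
theorem nodal_z (H : ARel n lam e a b) (hs : ∀ k, k ≤ n → tt lam (n - k) = tt lam k) :
    aeval (zz n lam e a b) (Lagrange.nodal (Finset.range ((n + 1) / 2)) (tt lam)) = 0 := by
  rw [← mul_one (aeval _ _), ← H.sum, Finset.mul_sum]
  apply Finset.sum_eq_zero
  intro i hi
  rw [Finset.mem_range] at hi
  by_cases h : i + 1 ≤ (n + 1) / 2
  · exact nodal_le h _ _ (H.nodal_e_low i)
  · exact nodal_le (m := (n - 1 - i) + 1) (by omega) _ _ (H.nodal_e_high hs _ i (by omega))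

/-- the central idempotents -/
noncomputable def eps (n : ℕ) (lam : ℕ → ℂ) (e a b : ℕ → A) (k : ℕ) : A :=
  Polynomial.aeval (zz n lam e a b)
    (Lagrange.basis (Finset.range ((n + 1) / 2)) (tt lam) k)

open Polynomial in
theorem z_eps (H : ARel n lam e a b) (hs : ∀ k, k ≤ n → tt lam (n - k) = tt lam k)
    {k : ℕ} (hk : k < (n + 1) / 2) :
    zz n lam e a b * eps n lam e a b k = tt lam k • eps n lam e a b k := by
  have hk' : k ∈ Finset.range ((n + 1) / 2) := Finset.mem_range.2 hk
  have h1 : (X - C (tt lam k)) * Lagrange.basis (Finset.range ((n + 1) / 2)) (tt lam) k =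
      C (Lagrange.nodalWeight (Finset.range ((n + 1) / 2)) (tt lam) k) *
        Lagrange.nodal (Finset.range ((n + 1) / 2)) (tt lam) := by
    rw [Lagrange.basis_eq_prod_sub_inv_mul_nodal_div hk', ← Lagrange.nodal_erase_eq_nodal_div hk',
      Lagrange.nodal_eq_mul_nodal_erase hk']
    ring
  have h2 := congrArg (aeval (zz n lam e a b)) h1
  rw [map_mul, map_mul, H.nodal_z hs, mul_zero, map_sub, aeval_X, aeval_C, sub_mul,
    ← Algebra.smul_def, sub_eq_zero] at h2
  exact h2

theorem eps_comm_e (H : ARel n lam e a b) (k i : ℕ) :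
    eps n lam e a b k * e i = e i * eps n lam e a b k := commute_aeval_of (H.z_comm_e i) _

theorem eps_comm_a (H : ARel n lam e a b) (k i : ℕ) :
    eps n lam e a b k * a i = a i * eps n lam e a b k := commute_aeval_of (H.z_comm_a i) _

theorem eps_comm_b (H : ARel n lam e a b) (k i : ℕ) :
    eps n lam e a b k * b i = b i * eps n lam e a b k := commute_aeval_of (H.z_comm_b i) _

theorem eps_z (H : ARel n lam e a b) (hs : ∀ k, k ≤ n → tt lam (n - k) = tt lam k)
    {k : ℕ} (hk : k < (n + 1) / 2) :
    eps n lam e a b k * zz n lam e a b = tt lam k • eps n lam e a b k := by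
  rw [← H.z_eps hs hk]
  exact commute_aeval_of rfl _

theorem eps_ba (H : ARel n lam e a b) (hs : ∀ k, k ≤ n → tt lam (n - k) = tt lam k)
    {k : ℕ} (hk : k < (n + 1) / 2) (i : ℕ) :
    eps n lam e a b k * (b i * a i) =
      (tt lam k - tt lam (i + 1)) • (eps n lam e a b k * e i) := by
  have h := H.z_e i
  rw [← sub_eq_iff_eq_add] at h
  rw [← h, mul_sub, ← mul_assoc, H.eps_z hs hk, mul_smul_comm, smul_mul_assoc, sub_smul]

theorem eps_ab (H : ARel n lam e a b) (hs : ∀ k, k ≤ n → tt lam (n - k) = tt lam k)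
    {k : ℕ} (hk : k < (n + 1) / 2) (i : ℕ) :
    eps n lam e a b k * (a i * b i) =
      (tt lam k - tt lam (i + 1)) • (eps n lam e a b k * e (i + 1)) := by
  have h := H.z_e_succ i
  rw [← sub_eq_iff_eq_add] at h
  rw [← h, mul_sub, ← mul_assoc, H.eps_z hs hk, mul_smul_comm, smul_mul_assoc, sub_smul]

theorem eps_e_low (H : ARel n lam e a b) (hs : ∀ k, k ≤ n → tt lam (n - k) = tt lam k)
    (hne : ∀ j k, j < k → k ≤ n / 2 → tt lam j ≠ tt lam k)
    {k : ℕ} (hk : k < (n + 1) / 2) (i : ℕ) (hi : i < k) : eps n lam e a b k * e i = 0 := by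
  have h0 := hne i k hi (by omega)
  induction i with
  | zero =>
    have h1 : eps n lam e a b k * (zz n lam e a b * e 0) = 0 := by rw [H.z_e_zero, mul_zero]
    rw [← mul_assoc, H.eps_z hs hk, smul_mul_assoc] at h1
    refine (smul_eq_zero.1 h1).resolve_left ?_
    simpa [tt, eq_comm] using h0
  | succ i ih =>
    have h1 := H.eps_ab hs hk i
    rw [← H.ae, mul_assoc, ← mul_assoc, H.eps_comm_a, mul_assoc, ← mul_assoc (eps _ _ _ _ _ _),
      ih (by omega) (hne _ _ (by omega) (by omega)), zero_mul, mul_zero] at h1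
    exact (smul_eq_zero.1 h1.symm).resolve_left (sub_ne_zero.2 h0.symm)

theorem eps_e_high (H : ARel n lam e a b) (hs : ∀ k, k ≤ n → tt lam (n - k) = tt lam k)
    (hne : ∀ j k, j < k → k ≤ n / 2 → tt lam j ≠ tt lam k)
    {k : ℕ} (hk : k < (n + 1) / 2) (j : ℕ) (hj : j < k) (i : ℕ) (hij : i + j + 1 = n) :
    eps n lam e a b k * e i = 0 := by
  have h0 := hne j k hj (by omega)
  have h1 := H.eps_ba hs hk i
  rw [show i + 1 = n - j by omega, hs j (by omega)] at h1
  have h2 : eps n lam e a b k * (b i * a i) = 0 := by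
    induction j generalizing i with
    | zero => rw [H.a0 i (by omega)]; simp
    | succ j ih =>
      have h3 := hne j k (by omega) (by omega)
      have h4 := H.eps_ba hs hk (i + 1)
      rw [show i + 1 + 1 = n - j by omega, hs j (by omega)] at h4
      have h5 := ih (by omega) (i + 1) (by omega) h3 h4
      rw [h5] at h4
      have h6 := (smul_eq_zero.1 h4.symm).resolve_left (sub_ne_zero.2 h3.symm)
      rw [← H.be, mul_assoc, ← mul_assoc, H.eps_comm_b, mul_assoc, ← mul_assoc (eps _ _ _ _ _ _),
        h6, zero_mul, mul_zero]
  rw [h2] at h1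
  exact (smul_eq_zero.1 h1.symm).resolve_left (sub_ne_zero.2 h0.symm)

theorem eps_e_out (H : ARel n lam e a b) (hs : ∀ k, k ≤ n → tt lam (n - k) = tt lam k)
    (hne : ∀ j k, j < k → k ≤ n / 2 → tt lam j ≠ tt lam k)
    {k : ℕ} (hk : k < (n + 1) / 2) (i : ℕ) (hi : i < k ∨ n ≤ i + k) :
    eps n lam e a b k * e i = 0 := by
  by_cases h : n ≤ i
  · rw [H.e0 i h, mul_zero]
  rcases hi with hi | hi
  · exact H.eps_e_low hs hne hk i hi
  · exact H.eps_e_high hs hne hk (n - 1 - i) (by omega) i (by omega)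

theorem sum_eps (hne : ∀ j k, j < k → k ≤ n / 2 → tt lam j ≠ tt lam k) (hn : 2 ≤ n)
    (e a b : ℕ → A) : ∑ k ∈ Finset.range ((n + 1) / 2), eps n lam e a b k = 1 := by
  simp only [eps]
  rw [← map_sum, Lagrange.sum_basis, map_one]
  · intro i hi j hj hij
    simp at hi hj
    by_contra h
    rcases Nat.lt_or_gt_of_ne h with h | h
    · exact hne i j h (by omega) hij
    · exact hne j i h (by omega) hij.symm
  · exact ⟨0, by simp; omega⟩

theorem cc_ne (hs : ∀ k, k ≤ n → tt lam (n - k) = tt lam k)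
    (hne : ∀ j k, j < k → k ≤ n / 2 → tt lam j ≠ tt lam k) {k d : ℕ} (h : d < n - 2 * k) :
    cc lam k d ≠ 0 := by
  rw [cc, Finset.prod_ne_zero_iff]
  intro l hl
  rw [Finset.mem_range] at hl
  rw [sub_ne_zero]
  by_cases h : k + l + 1 ≤ n / 2
  · exact hne _ _ (by omega) h
  · rw [← hs (k + l + 1) (by omega)]
    exact hne _ _ (by omega) (by omega)

theorem e_U (H : ARel n lam e a b) (k d i : ℕ) :
    e i * UU e a k d = if i = k + d then UU e a k d else 0 := by
  cases d with
  | zero => 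
    rw [UU, H.ee]; by_cases h : i = k <;> simp [h]
  | succ d =>
    rw [UU, ← mul_assoc]
    by_cases h : i = k + (d + 1)
    · rw [if_pos h, h, ← add_assoc, H.ea]
    · rw [if_neg h, H.ea_ne (by omega), zero_mul]

theorem eps_UW (H : ARel n lam e a b) (hs : ∀ k, k ≤ n → tt lam (n - k) = tt lam k)
    {k : ℕ} (hk : k < (n + 1) / 2) (d : ℕ) :
    eps n lam e a b k * (UU e a k d * WW e b k d) =
      cc lam k d • (eps n lam e a b k * e (k + d)) := by
  induction d with
  | zero => simp [UU, WW, cc, H.e_self]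
  | succ d ih =>
    rw [UU, WW, show ∀ x y u v : A, (x * u) * (v * y) = x * (u * v) * y by
      intros; simp only [mul_assoc], ← mul_assoc, ← mul_assoc, H.eps_comm_a,
      mul_assoc (a _), ih, mul_smul_comm, smul_mul_assoc, ← mul_assoc, ← H.eps_comm_a, mul_assoc,
      mul_assoc, H.eb, H.eps_ab hs hk, smul_smul, cc, cc, Finset.prod_range_succ]
    rfl

/-- spanning -/
theorem span_top (H : ARel n lam e a b) (hs : ∀ k, k ≤ n → tt lam (n - k) = tt lam k)
    (hne : ∀ j k, j < k → k ≤ n / 2 → tt lam j ≠ tt lam k) (hn : 2 ≤ n)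
    (S : Submodule ℂ A)
    (hS : ∀ k i j, k < (n + 1) / 2 → i < n - 2 * k → j < n - 2 * k →
      eps n lam e a b k * (UU e a k i * WW e b k j) ∈ S)
    (hS' : ∀ T : Submodule ℂ A, 1 ∈ T → (∀ i, ∀ x ∈ T, e i * x ∈ T) →
      (∀ i, ∀ x ∈ T, a i * x ∈ T) → (∀ i, ∀ x ∈ T, b i * x ∈ T) → T = ⊤) : S = ⊤ := by
  set T : Submodule ℂ A := Submodule.span ℂ {x | ∃ k i j, k < (n + 1) / 2 ∧ i < n - 2 * k ∧
    j < n - 2 * k ∧ x = eps n lam e a b k * (UU e a k i * WW e b k j)} with hT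
  have hmem : ∀ k i j, k < (n + 1) / 2 → i < n - 2 * k → j < n - 2 * k →
      eps n lam e a b k * (UU e a k i * WW e b k j) ∈ T := fun k i j h1 h2 h3 =>
    Submodule.subset_span ⟨k, i, j, h1, h2, h3, rfl⟩
  have hle : T ≤ S := by
    rw [hT, Submodule.span_le]
    rintro x ⟨k, i, j, h1, h2, h3, rfl⟩
    exact hS k i j h1 h2 h3
  have key : ∀ g : A, (∀ k i j, k < (n + 1) / 2 → i < n - 2 * k → j < n - 2 * k →
      g * (eps n lam e a b k * (UU e a k i * WW e b k j)) ∈ T) → ∀ x ∈ T, g * x ∈ T := by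
    intro g hg x hx
    induction hx using Submodule.span_induction with
    | mem x hx => obtain ⟨k, i, j, h1, h2, h3, rfl⟩ := hx; exact hg k i j h1 h2 h3
    | zero => simp
    | add x y _ _ hx hy => rw [mul_add]; exact T.add_mem hx hy
    | smul c x _ hx => rw [mul_smul_comm]; exact T.smul_mem c hx
  rw [eq_top_iff, ← hS' T ?_ ?_ ?_ ?_]
  · exact hle
  · rw [← sum_eps hne hn e a b]
    refine T.sum_mem fun k hk => ?_
    rw [Finset.mem_range] at hk
    rw [← mul_one (eps _ _ _ _ _ _), ← H.sum, Finset.mul_sum]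
    refine T.sum_mem fun i hi => ?_
    by_cases h : i < k ∨ n ≤ i + k
    · rw [H.eps_e_out hs hne hk i h]; exact T.zero_mem
    · have h1 := H.eps_UW hs hk (i - k)
      have h2 := hmem k (i - k) (i - k) hk (by omega) (by omega)
      rw [h1, show k + (i - k) = i by omega] at h2
      have h3 := T.smul_mem (cc lam k (i - k))⁻¹ h2
      rwa [smul_smul, inv_mul_cancel₀ (cc_ne hs hne (by omega)), one_smul] at h3
  · intro l
    refine key _ fun k i j hk hi hj => ?_
    rw [← mul_assoc, ← H.eps_comm_e, mul_assoc, ← mul_assoc (e l), H.e_U]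
    split_ifs
    · exact hmem k i j hk hi hj
    · simp
  · intro l
    refine key _ fun k i j hk hi hj => ?_
    rw [← mul_assoc, ← H.eps_comm_a, mul_assoc, ← mul_assoc (a l)]
    by_cases hl : l = k + i
    · subst hl
      change _ * (UU e a k (i + 1) * _) ∈ T
      by_cases h : i + 1 < n - 2 * k
      · exact hmem k (i + 1) j hk h hj
      · have := H.e_U k (i + 1) (k + (i + 1))
        rw [if_pos rfl] at this
        rw [← this, ← mul_assoc, ← mul_assoc, H.eps_e_out hs hne hk _ (by omega)]
        simp
    · have := H.e_U k i l
      rw [if_neg hl] at this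
      rw [← H.ae l, mul_assoc (a l), this]; simp
  · intro l
    refine key _ fun k i j hk hi hj => ?_
    rw [← mul_assoc, ← H.eps_comm_b, mul_assoc, ← mul_assoc (b l)]
    have h0 := H.e_U k i (l + 1)
    by_cases hl : l + 1 = k + i
    · rcases i with _ | i
      · rw [← H.eb l, mul_assoc (e l), mul_assoc (e l), ← mul_assoc,
          H.eps_e_out hs hne hk _ (by omega)]
        simp
      · have hl' : l = k + i := by omega
        subst hl'
        have h1 := H.eps_ba hs hk (k + i)
        have h2 := H.e_U k i (k + i)
        rw [if_pos rfl] at h2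
        rw [UU, ← mul_assoc (b _), mul_assoc (b _ * a _), ← mul_assoc, h1, smul_mul_assoc, mul_assoc,
          ← mul_assoc (e _), h2]
        exact T.smul_mem _ (hmem k i j hk (by omega) hj)
    · rw [if_neg hl] at h0
      rw [← H.be l, mul_assoc (b l), h0]; simp

end ARel

section blocks

variable (n : ℕ) (lam : ℕ → ℂ) (k : ℕ)

def mE (i : ℕ) : Matrix (Fin (n - 2 * k)) (Fin (n - 2 * k)) ℂ :=
  Matrix.diagonal fun r => if k + r.1 = i then 1 else 0

def mA (i : ℕ) : Matrix (Fin (n - 2 * k)) (Fin (n - 2 * k)) ℂ :=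
  Matrix.of fun r s => if k + s.1 = i ∧ r.1 = s.1 + 1 then 1 else 0

noncomputable def mB (i : ℕ) : Matrix (Fin (n - 2 * k)) (Fin (n - 2 * k)) ℂ :=
  Matrix.of fun r s => if k + r.1 = i ∧ s.1 = r.1 + 1 then tt lam k - tt lam (i + 1) else 0

theorem sum_single_fin {m : ℕ} (f : Fin m → ℂ) (d : ℕ) (hd : d < m)
    (h : ∀ x : Fin m, x.1 ≠ d → f x = 0) : ∑ x, f x = f ⟨d, hd⟩ :=
  Fintype.sum_eq_single _ fun x hx => h x fun h' => hx (Fin.ext h')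

theorem mAB (i : ℕ) : mA n k i * mB n lam k i =
    Matrix.diagonal fun r => if k + r.1 = i + 1 then tt lam k - tt lam (i + 1) else 0 := by
  ext r s
  rw [Matrix.mul_apply, Matrix.diagonal_apply]
  by_cases h : k ≤ i ∧ i - k < n - 2 * k
  · rw [sum_single_fin _ (i - k) h.2]
    · simp only [mA, mB, Matrix.of_apply]
      rw [show k + (i - k) = i by omega]
      simp only [true_and, Fin.ext_iff]
      try simp only [true_and, and_true]
      split_ifs <;> first | omega | simp
    · intro x hx
      simp only [mA, Matrix.of_apply]
      rw [if_neg (by omega), zero_mul]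
  · rw [Finset.sum_eq_zero]
    · split_ifs with h1 h2
      · have := r.2
        have h3 : k = i + 1 := by omega
        rw [h3, sub_self]
      · rfl
      · rfl
    · intro x _
      have := x.2
      simp only [mA, Matrix.of_apply]
      rw [if_neg (by omega), zero_mul]

theorem mBA (hs : ∀ k, k ≤ n → tt lam (n - k) = tt lam k) (i : ℕ) :
    mB n lam k i * mA n k i =
    Matrix.diagonal fun r => if k + r.1 = i then tt lam k - tt lam (i + 1) else 0 := by
  ext r s
  rw [Matrix.mul_apply, Matrix.diagonal_apply]
  by_cases h : r.1 + 1 < n - 2 * k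
  · rw [sum_single_fin _ (r.1 + 1) h]
    · simp only [mA, mB, Matrix.of_apply]
      simp only [Fin.ext_iff]
      try simp only [true_and, and_true]
      split_ifs <;> first | omega | simp
    · intro x hx
      simp only [mB, Matrix.of_apply]
      rw [if_neg (by omega), zero_mul]
  · rw [Finset.sum_eq_zero]
    · split_ifs with h1 h2
      · have := r.2
        rw [show i + 1 = n - k by omega, hs k (by omega), sub_self]
      · rfl
      · rfl
    · intro x _
      have := x.2
      simp only [mB, Matrix.of_apply]
      rw [if_neg (by omega), zero_mul]

theorem mRel (hs : ∀ k, k ≤ n → tt lam (n - k) = tt lam k) :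
    ARel n lam (mE n k) (mA n k) (mB n lam k) where
  ee i j := by
    rw [mE, mE, Matrix.diagonal_mul_diagonal]
    by_cases h : i = j
    · rw [if_pos h, ← h]; congr 1; ext r; split_ifs <;> simp
    · rw [if_neg h, ← Matrix.diagonal_zero]; congr 1; ext r; split_ifs <;> first | omega | simp
  sum := by
    ext r s
    rw [Matrix.sum_apply, Matrix.one_apply]
    simp only [mE, Matrix.diagonal_apply]
    by_cases h : r = s
    · simp only [if_pos h]
      have := r.2
      rw [Finset.sum_ite_eq, if_pos (Finset.mem_range.2 (by omega))]
    · simp [h]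
  e0 i hi := by
    rw [mE, ← Matrix.diagonal_zero]; congr 1; ext r
    have := r.2
    rw [if_neg (by omega)]
  a0 i hi := by
    ext r s
    have := r.2
    simp only [mA, Matrix.of_apply, Matrix.zero_apply]
    rw [if_neg (by omega)]
  b0 i hi := by
    ext r s
    have := s.2
    simp only [mB, Matrix.of_apply, Matrix.zero_apply]
    rw [if_neg (by omega)]
  ae i := by
    ext r s
    rw [mE, Matrix.mul_diagonal]
    simp only [mA, Matrix.of_apply]
    try simp only [true_and, and_true]
    split_ifs <;> first | omega | simp
  ea i := by
    ext r s
    rw [mE, Matrix.diagonal_mul]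
    simp only [mA, Matrix.of_apply]
    try simp only [true_and, and_true]
    split_ifs <;> first | omega | simp
  be i := by
    ext r s
    rw [mE, Matrix.mul_diagonal]
    simp only [mB, Matrix.of_apply]
    try simp only [true_and, and_true]
    split_ifs <;> first | omega | simp
  eb i := by
    ext r s
    rw [mE, Matrix.diagonal_mul]
    simp only [mB, Matrix.of_apply]
    try simp only [true_and, and_true]
    split_ifs <;> first | omega | simp
  r0 := by
    rw [mBA n lam k hs]
    ext r s
    simp only [mE, Matrix.neg_apply, Matrix.smul_apply, Matrix.diagonal_apply]
    split_ifs with h1 h2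
    · have : k = 0 := by omega
      subst this
      simp [tt]
    all_goals simp
  rs i := by
    rw [mBA n lam k hs, mAB]
    ext r s
    simp only [mE, Matrix.sub_apply, Matrix.smul_apply, Matrix.diagonal_apply]
    split_ifs with h1 h2
    · rw [ARel.tt_succ lam (i + 1)]; simp
    all_goals simp

theorem mZ (hs : ∀ k, k ≤ n → tt lam (n - k) = tt lam k) :
    zz n lam (mE n k) (mA n k) (mB n lam k) =
      algebraMap ℂ (Matrix (Fin (n - 2 * k)) (Fin (n - 2 * k)) ℂ) (tt lam k) := by
  have h : ∀ i, mB n lam k i * mA n k i + tt lam (i + 1) • mE n k i = tt lam k • mE n k i := by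
    intro i
    rw [mBA n lam k hs]
    ext r s
    simp only [mE, Matrix.add_apply, Matrix.smul_apply, Matrix.diagonal_apply]
    split_ifs <;> simp
  rw [zz, Finset.sum_congr rfl fun i _ => h i, ← Finset.smul_sum, (mRel n lam k hs).sum,
    Algebra.algebraMap_eq_smul_one]

theorem mU (d : ℕ) : UU (mE n k) (mA n k) k d =
    Matrix.of fun r s => if r.1 = d ∧ s.1 = 0 then 1 else 0 := by
  induction d with
  | zero =>
    ext r s
    simp only [UU, mE, Matrix.diagonal_apply, Matrix.of_apply, Fin.ext_iff]
    try simp only [true_and, and_true]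
    split_ifs <;> first | omega | simp
  | succ d ih =>
    ext r s
    rw [UU, ih, Matrix.mul_apply]
    by_cases h : d < n - 2 * k
    · rw [sum_single_fin _ d h]
      · simp only [mA, Matrix.of_apply]
        try simp only [true_and, and_true]
        split_ifs <;> first | omega | simp
      · intro x hx
        simp only [mA, Matrix.of_apply]
        rw [if_neg (by omega), zero_mul]
    · have := r.2
      rw [Finset.sum_eq_zero]
      · simp only [Matrix.of_apply]
        rw [if_neg (by omega)]
      · intro x _
        have := x.2
        simp only [mA, Matrix.of_apply]
        rw [if_neg (by omega), zero_mul]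

theorem mW (d : ℕ) : WW (mE n k) (mB n lam k) k d =
    Matrix.of fun r s => if r.1 = 0 ∧ s.1 = d then cc lam k d else 0 := by
  induction d with
  | zero =>
    ext r s
    simp only [WW, mE, Matrix.diagonal_apply, Matrix.of_apply, Fin.ext_iff]
    try simp only [true_and, and_true]
    split_ifs <;> first | omega | simp [cc]
  | succ d ih =>
    ext r s
    rw [WW, ih, Matrix.mul_apply]
    by_cases h : d < n - 2 * k
    · rw [sum_single_fin _ d h]
      · simp only [mB, Matrix.of_apply, cc, Finset.prod_range_succ]
        try simp only [true_and, and_true]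
        split_ifs <;> first | omega | simp
      · intro x hx
        simp only [mB, Matrix.of_apply]
        rw [if_neg (by omega), zero_mul]
    · have := s.2
      rw [Finset.sum_eq_zero]
      · simp only [Matrix.of_apply]
        rw [if_neg (by omega)]
      · intro x _
        have := x.2
        simp only [mB, Matrix.of_apply]
        rw [if_neg (by omega), zero_mul]

theorem mUW (i j : ℕ) : UU (mE n k) (mA n k) k i * WW (mE n k) (mB n lam k) k j =
    Matrix.of fun r s => if r.1 = i ∧ s.1 = j then cc lam k j else 0 := by
  ext r s
  have := r.2
  rw [mU, mW, Matrix.mul_apply, sum_single_fin _ 0 (by omega)]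
  · simp only [Matrix.of_apply]
    try simp only [true_and, and_true]
    split_ifs <;> first | omega | simp
  · intro x hx
    simp only [Matrix.of_apply]
    rw [if_neg (by omega), zero_mul]

end blocks

section maps

variable {A B : Type*} [Ring A] [Algebra ℂ A] [Ring B] [Algebra ℂ B]

theorem map_zz (f : A →ₐ[ℂ] B) (n : ℕ) (lam : ℕ → ℂ) (e a b : ℕ → A) :
    f (zz n lam e a b) = zz n lam (fun i => f (e i)) (fun i => f (a i)) (fun i => f (b i)) := by
  simp [zz, map_sum]

theorem map_UU (f : A →ₐ[ℂ] B) (e a : ℕ → A) (k d : ℕ) :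
    f (UU e a k d) = UU (fun i => f (e i)) (fun i => f (a i)) k d := by
  induction d with
  | zero => rfl
  | succ d ih => rw [UU, map_mul, ih, UU]

theorem map_WW (f : A →ₐ[ℂ] B) (e b : ℕ → A) (k d : ℕ) :
    f (WW e b k d) = WW (fun i => f (e i)) (fun i => f (b i)) k d := by
  induction d with
  | zero => rfl
  | succ d ih => rw [WW, map_mul, ih, WW]

end maps

theorem phi_F {A : Type*} [Ring A] [Algebra ℂ A] (n : ℕ) (lam : ℕ → ℂ) (e a b : ℕ → A)
    (hs : ∀ k, k ≤ n → tt lam (n - k) = tt lam k)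
    (hne : ∀ j k, j < k → k ≤ n / 2 → tt lam j ≠ tt lam k)
    (k' : ℕ) (hk' : k' < (n + 1) / 2)
    (f : A →ₐ[ℂ] Matrix (Fin (n - 2 * k')) (Fin (n - 2 * k')) ℂ)
    (he : ∀ i, f (e i) = mE n k' i) (ha : ∀ i, f (a i) = mA n k' i)
    (hb : ∀ i, f (b i) = mB n lam k' i) (k : ℕ) (hk : k < (n + 1) / 2) (i j : ℕ) :
    f (ARel.eps n lam e a b k * (UU e a k i * WW e b k j)) =
      Matrix.of fun r s => if k = k' ∧ r.1 = i ∧ s.1 = j then cc lam k j else 0 := by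
  rw [map_mul, map_mul, map_UU, map_WW, ARel.eps, ← Polynomial.aeval_algHom_apply, map_zz]
  simp only [he, ha, hb]
  rw [show zz n lam (fun i => mE n k' i) (fun i => mA n k' i) (fun i => mB n lam k' i) = _ from
    mZ n lam k' hs, Polynomial.aeval_algebraMap_apply, Polynomial.coe_aeval_eq_eval]
  by_cases h : k = k'
  · subst h
    rw [Lagrange.eval_basis_self, map_one, one_mul]
    · rw [show UU (fun i => mE n k i) (fun i => mA n k i) k i *
        WW (fun i => mE n k i) (fun i => mB n lam k i) k j = _ from mUW n lam k i j]
      simp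
    · intro i hi j hj hij
      simp at hi hj
      by_contra h
      rcases Nat.lt_or_gt_of_ne h with h | h
      · exact hne i j h (by omega) hij
      · exact hne j i h (by omega) hij.symm
    · simpa using hk
  · rw [Lagrange.eval_basis_of_ne h (by simpa using hk'), map_zero, zero_mul]
    ext r s
    simp [h]

/-- abstract form of the main result -/
theorem abstract_iso {A : Type*} [Ring A] [Algebra ℂ A] (n : ℕ) (hn : 2 ≤ n) (lam : ℕ → ℂ)
    (e a b : ℕ → A) (H : ARel n lam e a b)
    (hs : ∀ k, k ≤ n → tt lam (n - k) = tt lam k)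
    (hne : ∀ j k, j < k → k ≤ n / 2 → tt lam j ≠ tt lam k)
    (hS' : ∀ T : Submodule ℂ A, 1 ∈ T → (∀ i, ∀ x ∈ T, e i * x ∈ T) →
      (∀ i, ∀ x ∈ T, a i * x ∈ T) → (∀ i, ∀ x ∈ T, b i * x ∈ T) → T = ⊤)
    (f : ∀ k : Fin ((n + 1) / 2), A →ₐ[ℂ] Matrix (Fin (n - 2 * k.1)) (Fin (n - 2 * k.1)) ℂ)
    (he : ∀ k i, f k (e i) = mE n k.1 i) (ha : ∀ k i, f k (a i) = mA n k.1 i)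
    (hb : ∀ k i, f k (b i) = mB n lam k.1 i) :
    Nonempty (A ≃ₐ[ℂ] ∀ k : Fin ((n + 1) / 2),
      Matrix (Fin (n - 2 * (k : ℕ))) (Fin (n - 2 * (k : ℕ))) ℂ) := by
  let F : A →ₐ[ℂ] ∀ k : Fin ((n + 1) / 2),
      Matrix (Fin (n - 2 * (k : ℕ))) (Fin (n - 2 * (k : ℕ))) ℂ := AlgHom.pi f
  let G : (∀ k : Fin ((n + 1) / 2),
      Matrix (Fin (n - 2 * (k : ℕ))) (Fin (n - 2 * (k : ℕ))) ℂ) →ₗ[ℂ] A :=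
    { toFun := fun X => ∑ k, ∑ i, ∑ j, (X k i j * (cc lam k.1 j.1)⁻¹) •
        (ARel.eps n lam e a b k.1 * (UU e a k.1 i.1 * WW e b k.1 j.1))
      map_add' := by
        intro X Y
        simp only [Pi.add_apply, Matrix.add_apply, add_mul, add_smul, Finset.sum_add_distrib]
      map_smul' := by
        intro c X
        simp only [Pi.smul_apply, Matrix.smul_apply, smul_eq_mul, mul_assoc, mul_smul,
          Finset.smul_sum, RingHom.id_apply] }
  have hFG : ∀ X, F (G X) = X := by
    intro X
    funext k'
    change f k' (∑ k, ∑ i, ∑ j, (X k i j * (cc lam k.1 j.1)⁻¹) •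
        (ARel.eps n lam e a b k.1 * (UU e a k.1 i.1 * WW e b k.1 j.1))) = X k'
    simp only [map_sum, map_smul]
    ext r s
    simp only [phi_F n lam e a b hs hne k'.1 k'.2 (f k') (he k') (ha k') (hb k') _ (Fin.is_lt _),
      Matrix.sum_apply, Matrix.smul_apply, Matrix.of_apply]
    rw [Fintype.sum_eq_single k', Fintype.sum_eq_single r, Fintype.sum_eq_single s]
    · simp [ARel.cc_ne hs hne s.2]
    · intro x hx
      rw [if_neg (by rintro ⟨_, _, h⟩; exact hx (Fin.ext h.symm)), smul_zero]
    · intro x hx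
      refine Finset.sum_eq_zero fun y _ => ?_
      rw [if_neg (by rintro ⟨_, h, _⟩; exact hx (Fin.ext h.symm)), smul_zero]
    · intro x hx
      refine Finset.sum_eq_zero fun y _ => Finset.sum_eq_zero fun y _ => ?_
      rw [if_neg (by rintro ⟨h, _, _⟩; exact hx (Fin.ext h)), smul_zero]
  have hG : LinearMap.range G = ⊤ := by
    refine H.span_top hs hne hn _ ?_ hS'
    intro k i j hk hi hj
    refine ⟨fun k' => Matrix.of fun i' j' =>
      if k'.1 = k ∧ i'.1 = i ∧ j'.1 = j then cc lam k j else 0, ?_⟩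
    change (∑ k' : Fin ((n + 1) / 2), ∑ i' : Fin (n - 2 * k'.1), ∑ j' : Fin (n - 2 * k'.1),
      ((if k'.1 = k ∧ i'.1 = i ∧ j'.1 = j then cc lam k j else 0) * (cc lam k'.1 j'.1)⁻¹) •
        (ARel.eps n lam e a b k'.1 * (UU e a k'.1 i'.1 * WW e b k'.1 j'.1))) = _
    rw [Fintype.sum_eq_single ⟨k, hk⟩, Fintype.sum_eq_single ⟨i, hi⟩,
      Fintype.sum_eq_single ⟨j, hj⟩]
    · simp [ARel.cc_ne hs hne hj]
    · intro x hx
      rw [if_neg (by rintro ⟨_, _, h⟩; exact hx (Fin.ext h)), zero_mul, zero_smul]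
    · intro x hx
      refine Finset.sum_eq_zero fun y _ => ?_
      rw [if_neg (by rintro ⟨_, h, _⟩; exact hx (Fin.ext h)), zero_mul, zero_smul]
    · intro x hx
      refine Finset.sum_eq_zero fun y _ => Finset.sum_eq_zero fun y _ => ?_
      rw [if_neg (by rintro ⟨h, _, _⟩; exact hx (Fin.ext h)), zero_mul, zero_smul]
  refine ⟨AlgEquiv.ofBijective F ⟨?_, fun X => ⟨G X, hFG X⟩⟩⟩
  intro x y hxy
  obtain ⟨X, rfl⟩ := LinearMap.range_eq_top.1 hG x
  obtain ⟨Y, rfl⟩ := LinearMap.range_eq_top.1 hG y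
  rw [hFG, hFG] at hxy
  rw [hxy]

section typeA_gens

variable (n : ℕ) (lam : Fin n → ℂ)

def lamN (i : ℕ) : ℂ := if h : i < n then lam ⟨i, h⟩ else 0

noncomputable def gE' (i : Fin n) : (typeA n).Deformed lam := (typeA n).gen lam (Sum.inl i)
noncomputable def gA' (i : Fin (n - 1)) : (typeA n).Deformed lam :=
  (typeA n).gen lam (Sum.inr (Sum.inl i))
noncomputable def gB' (i : Fin (n - 1)) : (typeA n).Deformed lam :=
  (typeA n).gen lam (Sum.inr (Sum.inr i))

noncomputable def gE (i : ℕ) : (typeA n).Deformed lam := if h : i < n then gE' n lam ⟨i, h⟩ else 0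
noncomputable def gA (i : ℕ) : (typeA n).Deformed lam :=
  if h : i < n - 1 then gA' n lam ⟨i, h⟩ else 0
noncomputable def gB (i : ℕ) : (typeA n).Deformed lam :=
  if h : i < n - 1 then gB' n lam ⟨i, h⟩ else 0

theorem gE'_mul (i j : Fin n) : gE' n lam i * gE' n lam j = if i = j then gE' n lam i else 0 := by
  have h := RingQuot.mkAlgHom_rel ℂ (PathRel.vertex_mul (Q := typeA n) (lam := lam) i j)
  rw [map_mul] at h
  refine h.trans ?_
  by_cases hij : i = j
  · subst hij
    rw [if_pos rfl]
    exact congrArg _ (if_pos rfl)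
  · rw [if_neg hij]
    exact (congrArg _ (if_neg hij)).trans (map_zero _)

theorem gE'_sum : ∑ i, gE' n lam i = 1 := by
  have h := RingQuot.mkAlgHom_rel ℂ (PathRel.sum_vertices (Q := typeA n) (lam := lam))
  rw [map_sum, map_one] at h
  exact h

theorem gA'_src (i : Fin (n - 1)) : gA' n lam i * gE' n lam ⟨i.1, by omega⟩ = gA' n lam i := by
  have h := RingQuot.mkAlgHom_rel ℂ (PathRel.arr_src (Q := typeA n) (lam := lam) (Sum.inl i))
  rw [map_mul] at h
  exact h

theorem gA'_tgt (i : Fin (n - 1)) : gE' n lam ⟨i.1 + 1, by omega⟩ * gA' n lam i = gA' n lam i := by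
  have h := RingQuot.mkAlgHom_rel ℂ (PathRel.arr_tgt (Q := typeA n) (lam := lam) (Sum.inl i))
  rw [map_mul] at h
  exact h

theorem gB'_src (i : Fin (n - 1)) : gB' n lam i * gE' n lam ⟨i.1 + 1, by omega⟩ = gB' n lam i := by
  have h := RingQuot.mkAlgHom_rel ℂ (PathRel.arr_src (Q := typeA n) (lam := lam) (Sum.inr i))
  rw [map_mul] at h
  exact h

theorem gB'_tgt (i : Fin (n - 1)) : gE' n lam ⟨i.1, by omega⟩ * gB' n lam i = gB' n lam i := by
  have h := RingQuot.mkAlgHom_rel ℂ (PathRel.arr_tgt (Q := typeA n) (lam := lam) (Sum.inr i))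
  rw [map_mul] at h
  exact h

theorem g_preproj : ∑ i : Fin (n - 1), (gA' n lam i * gB' n lam i - gB' n lam i * gA' n lam i) =
    ∑ i : Fin n, lam i • gE' n lam i := by
  have h := RingQuot.mkAlgHom_rel ℂ (PathRel.preproj (Q := typeA n) (lam := lam))
  simp only [map_sum, map_sub, map_mul, map_smul] at h
  exact h

theorem g_preproj' : ∑ i ∈ Finset.range (n - 1), (gA n lam i * gB n lam i - gB n lam i * gA n lam i) =
    ∑ i ∈ Finset.range n, lamN n lam i • gE n lam i := by
  rw [Finset.sum_range, Finset.sum_range]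
  simp only [gA, gB, gE, lamN, Fin.is_lt, dite_true, Fin.eta]
  exact g_preproj n lam

theorem gRel (hn : 2 ≤ n) : ARel n (lamN n lam) (gE n lam) (gA n lam) (gB n lam) := by
  have ee : ∀ i j, gE n lam i * gE n lam j = if i = j then gE n lam i else 0 := by
    intro i j
    by_cases hi : i < n
    · by_cases hj : j < n
      · simp only [gE, hi, hj, dite_true, gE'_mul, Fin.mk.injEq]
      · simp only [gE, hi, hj, dite_true, dite_false, mul_zero]
        rw [if_neg (by omega)]
    · simp only [gE, hi, dite_false, zero_mul, ite_self]
  have e_ne : ∀ {i j}, i ≠ j → gE n lam i * gE n lam j = 0 := fun h => by rw [ee, if_neg h]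
  have ae : ∀ i, gA n lam i * gE n lam i = gA n lam i := by
    intro i
    by_cases hi : i < n - 1
    · have : i < n := by omega
      simp only [gA, gE, hi, this, dite_true]; exact gA'_src n lam ⟨i, hi⟩
    · simp only [gA, hi, dite_false, zero_mul]
  have ea : ∀ i, gE n lam (i + 1) * gA n lam i = gA n lam i := by
    intro i
    by_cases hi : i < n - 1
    · have : i + 1 < n := by omega
      simp only [gA, gE, hi, this, dite_true]; exact gA'_tgt n lam ⟨i, hi⟩
    · simp only [gA, hi, dite_false, mul_zero]
  have be : ∀ i, gB n lam i * gE n lam (i + 1) = gB n lam i := by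
    intro i
    by_cases hi : i < n - 1
    · have : i + 1 < n := by omega
      simp only [gB, gE, hi, this, dite_true]; exact gB'_src n lam ⟨i, hi⟩
    · simp only [gB, hi, dite_false, zero_mul]
  have eb : ∀ i, gE n lam i * gB n lam i = gB n lam i := by
    intro i
    by_cases hi : i < n - 1
    · have : i < n := by omega
      simp only [gB, gE, hi, this, dite_true]; exact gB'_tgt n lam ⟨i, hi⟩
    · simp only [gB, hi, dite_false, mul_zero]
  have a0 : ∀ i, n ≤ i + 1 → gA n lam i = 0 := fun i hi => by
    rw [gA, dif_neg (by omega)]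
  have b0 : ∀ i, n ≤ i + 1 → gB n lam i = 0 := fun i hi => by
    rw [gB, dif_neg (by omega)]
  have e0 : ∀ i, n ≤ i → gE n lam i = 0 := fun i hi => by
    rw [gE, dif_neg (by omega)]
  have hab : ∀ j i, gE n lam j * (gA n lam i * gB n lam i) =
      if i + 1 = j then gA n lam i * gB n lam i else 0 := by
    intro j i
    rw [← mul_assoc]
    split_ifs with h
    · rw [← h, ea]
    · rw [← ea, ← mul_assoc, e_ne (Ne.symm h), zero_mul, zero_mul]
  have hba : ∀ j i, gE n lam j * (gB n lam i * gA n lam i) =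
      if i = j then gB n lam i * gA n lam i else 0 := by
    intro j i
    rw [← mul_assoc]
    split_ifs with h
    · rw [← h, eb]
    · rw [← eb, ← mul_assoc, e_ne (Ne.symm h), zero_mul, zero_mul]
  have hp := fun j => congrArg (fun x => gE n lam j * x) (g_preproj' n lam)
  simp only [Finset.mul_sum, mul_sub, hab, hba, mul_smul_comm, ee, smul_ite, smul_zero,
    Finset.sum_sub_distrib, Finset.sum_ite_eq, Finset.sum_ite_eq', Finset.mem_range] at hp
  refine ⟨ee, ?_, e0, a0, b0, ae, ea, be, eb, ?_, ?_⟩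
  · rw [Finset.sum_range]
    simp only [gE, Fin.is_lt, dite_true, Fin.eta]
    exact gE'_sum n lam
  · have h := hp 0
    rw [if_pos (by omega), if_pos (by omega), Finset.sum_eq_zero, zero_sub] at h
    · exact h
    · intro i _; rw [if_neg (by omega)]
  · intro i
    by_cases hi : i + 1 < n
    · have h := hp (i + 1)
      simp only [add_left_inj, Finset.sum_ite_eq', Finset.mem_range] at h
      rw [if_pos (show i < n - 1 by omega), if_pos hi] at h
      rw [← h]
      split_ifs
      · rfl
      · rw [a0 (i + 1) (by omega), mul_zero]
    · rw [a0 i (by omega), a0 (i + 1) (by omega), e0 (i + 1) (by omega)]; simp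

theorem ARel.preproj {B : Type*} [Ring B] [Algebra ℂ B] {n : ℕ} {lam : ℕ → ℂ} {e a b : ℕ → B}
    (H : ARel n lam e a b) (hn : 2 ≤ n) :
    ∑ i ∈ Finset.range (n - 1), (a i * b i - b i * a i) = ∑ i ∈ Finset.range n, lam i • e i := by
  obtain ⟨m, rfl⟩ : ∃ m, n = m + 1 := ⟨n - 1, by omega⟩
  rw [Finset.sum_range_succ', ← H.r0, Finset.sum_congr rfl fun i _ => (H.rs i).symm,
    Finset.sum_sub_distrib, Finset.sum_sub_distrib, Nat.add_sub_cancel]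
  have h1 := Finset.sum_range_succ (fun i => b i * a i) m
  rw [Finset.sum_range_succ', H.b0 m (by omega), zero_mul, add_zero] at h1
  rw [← h1]; abel

theorem lift_exists {B : Type*} [Ring B] [Algebra ℂ B] (hn : 2 ≤ n) {e a b : ℕ → B}
    (H : ARel n (lamN n lam) e a b) : ∃ f : (typeA n).Deformed lam →ₐ[ℂ] B,
      (∀ i, f (gE n lam i) = e i) ∧ (∀ i, f (gA n lam i) = a i) ∧ (∀ i, f (gB n lam i) = b i) := by
  let v : (typeA n).Gen → B := Sum.elim (fun i : Fin n => e i.1)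
    (Sum.elim (fun i : Fin (n - 1) => a i.1) (fun i : Fin (n - 1) => b i.1))
  have w : ∀ ⦃x y⦄, (typeA n).PathRel lam x y → FreeAlgebra.lift ℂ v x = FreeAlgebra.lift ℂ v y := by
    intro x y h
    induction h with
    | vertex_mul i j =>
      rw [map_mul, FreeAlgebra.lift_ι_apply, FreeAlgebra.lift_ι_apply]
      change e i.1 * e j.1 = _
      rw [H.ee]
      by_cases hij : i = j
      · subst hij
        rw [if_pos rfl, if_pos rfl, FreeAlgebra.lift_ι_apply]; rfl
      · rw [if_neg hij, map_zero, if_neg fun h => hij (Fin.ext h)]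
    | sum_vertices =>
      simp only [map_sum, map_one, FreeAlgebra.lift_ι_apply]
      rw [← H.sum, Finset.sum_range]; rfl
    | arr_src x =>
      rw [map_mul, FreeAlgebra.lift_ι_apply, FreeAlgebra.lift_ι_apply]
      rcases x with i | i
      · exact H.ae i.1
      · exact H.be i.1
    | arr_tgt x =>
      rw [map_mul, FreeAlgebra.lift_ι_apply, FreeAlgebra.lift_ι_apply]
      rcases x with i | i
      · exact H.ea i.1
      · exact H.eb i.1
    | preproj =>
      simp only [map_sum, map_sub, map_mul, map_smul, FreeAlgebra.lift_ι_apply]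
      have h := H.preproj hn
      rw [Finset.sum_range, Finset.sum_range] at h
      simp only [lamN, Fin.is_lt, dite_true, Fin.eta] at h
      exact h
  have hg : ∀ g, RingQuot.liftAlgHom ℂ ⟨FreeAlgebra.lift ℂ v, w⟩ ((typeA n).gen lam g) = v g := by
    intro g
    change RingQuot.liftAlgHom ℂ ⟨FreeAlgebra.lift ℂ v, w⟩
      (RingQuot.mkAlgHom ℂ _ (FreeAlgebra.ι ℂ g)) = _
    rw [RingQuot.liftAlgHom_mkAlgHom_apply, FreeAlgebra.lift_ι_apply]
  refine ⟨RingQuot.liftAlgHom ℂ ⟨FreeAlgebra.lift ℂ v, w⟩, ?_, ?_, ?_⟩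
  · intro i
    by_cases h : i < n
    · rw [gE, dif_pos h]; exact hg _
    · rw [gE, dif_neg h, map_zero, H.e0 i (by omega)]
  · intro i
    by_cases h : i < n - 1
    · rw [gA, dif_pos h]; exact hg _
    · rw [gA, dif_neg h, map_zero, H.a0 i (by omega)]
  · intro i
    by_cases h : i < n - 1
    · rw [gB, dif_pos h]; exact hg _
    · rw [gB, dif_neg h, map_zero, H.b0 i (by omega)]

theorem gen_top (T : Submodule ℂ ((typeA n).Deformed lam)) (h1 : 1 ∈ T)
    (he : ∀ i, ∀ x ∈ T, gE n lam i * x ∈ T) (ha : ∀ i, ∀ x ∈ T, gA n lam i * x ∈ T)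
    (hb : ∀ i, ∀ x ∈ T, gB n lam i * x ∈ T) : T = ⊤ := by
  have hgen : ∀ g : (typeA n).Gen, ∀ x ∈ T, (typeA n).gen lam g * x ∈ T := by
    rintro (i | i | i) x hx
    · have := he i.1 x hx
      have hi : i.1 < n := i.2
      rw [gE, dif_pos hi] at this
      exact this
    · have := ha i.1 x hx
      have hi : i.1 < n - 1 := i.2
      rw [gA, dif_pos hi] at this
      exact this
    · have := hb i.1 x hx
      have hi : i.1 < n - 1 := i.2
      rw [gB, dif_pos hi] at this
      exact this
  have key : ∀ y : FreeAlgebra ℂ (typeA n).Gen, ∀ x ∈ T,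
      RingQuot.mkAlgHom ℂ ((typeA n).PathRel lam) y * x ∈ T := by
    intro y
    induction y using FreeAlgebra.induction with
    | grade0 r =>
      intro x hx
      rw [AlgHom.commutes, ← Algebra.smul_def]; exact T.smul_mem r hx
    | grade1 g => exact hgen g
    | mul p q hp hq =>
      intro x hx
      rw [map_mul, mul_assoc]; exact hp _ (hq _ hx)
    | add p q hp hq =>
      intro x hx
      rw [map_add, add_mul]; exact T.add_mem (hp _ hx) (hq _ hx)
  rw [eq_top_iff]
  intro x _
  obtain ⟨y, rfl⟩ := RingQuot.mkAlgHom_surjective ℂ ((typeA n).PathRel lam) x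
  have := key y 1 h1
  rwa [mul_one] at this

theorem tt_symm (h : ∀ i, lam ((typeA n).nu i) = -lam i) (k : ℕ) (hk : k ≤ n) :
    tt (lamN n lam) (n - k) = tt (lamN n lam) k := by
  have h' : ∀ i, i < n → lamN n lam (n - 1 - i) = - lamN n lam i := by
    intro i hi
    rw [lamN, lamN, dif_pos hi, dif_pos (by omega)]
    exact h ⟨i, hi⟩
  have hz : tt (lamN n lam) n = 0 := by
    have h2 := Finset.sum_range_reflect (lamN n lam) n
    rw [Finset.sum_congr rfl fun i hi => h' i (Finset.mem_range.1 hi), Finset.sum_neg_distrib] at h2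
    exact self_eq_neg.1 h2.symm
  induction k with
  | zero => rw [Nat.sub_zero, hz]; simp [tt]
  | succ k ih =>
    have h3 := ih (by omega)
    rw [show n - k = n - (k + 1) + 1 by omega, ARel.tt_succ] at h3
    have h4 := h' k (by omega)
    rw [show n - 1 - k = n - (k + 1) by omega] at h4
    rw [ARel.tt_succ, ← h3, h4]; ring

noncomputable def genPoly : MvPolynomial (Fin n) ℂ :=
  ∏ k ∈ Finset.range (n / 2 + 1), ∏ j ∈ Finset.range k,
    ∑ i ∈ Finset.Ico j k, if h : i < n then MvPolynomial.X ⟨i, h⟩ else 0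

theorem eval_genPoly : MvPolynomial.eval lam (genPoly n) =
    ∏ k ∈ Finset.range (n / 2 + 1), ∏ j ∈ Finset.range k,
      (tt (lamN n lam) k - tt (lamN n lam) j) := by
  simp only [genPoly, map_prod, map_sum]
  refine Finset.prod_congr rfl fun k _ => Finset.prod_congr rfl fun j hj => ?_
  rw [tt, tt, ← Finset.sum_Ico_eq_sub _ (Finset.mem_range.1 hj).le]
  refine Finset.sum_congr rfl fun i _ => ?_
  rw [lamN]
  split_ifs <;> simp

end typeA_gens

/-!
STATEMENT 18: let `Q` be a quiver of type `Aₙ` with `n ≥ 2`, and let `λ : I → ℂ` be a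
generic weight with `ν λ = -λ`.  Then the deformed preprojective algebra
`A_λ = ℂQ̄ / (∑_{a ∈ Q} [a, a*] - ∑_i λ_i e_i)` is semisimple, with simple modules of
dimensions `n, n-2, n-4, …`.

Here `A_λ` is the quotient `Q.Deformed lam` of the path algebra of the double quiver
by the deformed preprojective relation (see `ADEQuiver.PathRel`).  "Generic" is
rendered as: there is a polynomial function `p` of `λ`, not identically zero on the
space `K = {λ : ν λ = -λ}`, such that the conclusion holds whenever `λ ∈ K` and
`p(λ) ≠ 0`.  "Semisimple with simple modules of dimensions `n, n-2, …`" is rendered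
as: `A_λ` is a semisimple ring, isomorphic as a ℂ-algebra to the product
`∏_{k=0}^{⌈n/2⌉ - 1} Mat_{n-2k}(ℂ)` (whose simple modules have dimensions
`n, n-2, n-4, …`). -/
theorem deformed_typeA_preprojective_algebra_semisimple (n : ℕ) (hn : 2 ≤ n) :
    ∃ p : MvPolynomial (Fin n) ℂ,
      (∃ lam₀ : Fin n → ℂ, (∀ i, lam₀ ((typeA n).nu i) = -lam₀ i) ∧
          MvPolynomial.eval lam₀ p ≠ 0) ∧
      (∀ lam : Fin n → ℂ, (∀ i, lam ((typeA n).nu i) = -lam i) →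
        MvPolynomial.eval lam p ≠ 0 →
          IsSemisimpleRing ((typeA n).Deformed lam) ∧
          Nonempty (((typeA n).Deformed lam) ≃ₐ[ℂ]
            ∀ k : Fin ((n + 1) / 2),
              Matrix (Fin (n - 2 * (k : ℕ))) (Fin (n - 2 * (k : ℕ))) ℂ)) := by
  refine ⟨genPoly n, ?_, ?_⟩
  · refine ⟨fun i => ((n : ℂ) - 1 - 2 * (i.1 : ℂ)), ?_, ?_⟩
    · intro i
      have hi : i.1 < n := i.2
      change (n : ℂ) - 1 - 2 * ((n - 1 - i.1 : ℕ) : ℂ) = -((n : ℂ) - 1 - 2 * (i.1 : ℂ))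
      rw [Nat.cast_sub (by omega), Nat.cast_sub (by omega)]
      push_cast
      ring
    · have ht : ∀ k, k ≤ n → tt (lamN n fun i => ((n : ℂ) - 1 - 2 * (i.1 : ℂ))) k =
          (k : ℂ) * ((n : ℂ) - k) := by
        intro k hk
        induction k with
        | zero => simp [tt]
        | succ k ih =>
          rw [ARel.tt_succ, ih (by omega), lamN, dif_pos (by omega)]
          push_cast
          ring
      rw [eval_genPoly, Finset.prod_ne_zero_iff]
      intro k hk
      rw [Finset.prod_ne_zero_iff]
      intro j hj
      rw [Finset.mem_range] at hk hj
      rw [ht k (by omega), ht j (by omega)]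
      have h1 : (k : ℂ) * ((n : ℂ) - k) - (j : ℂ) * ((n : ℂ) - j) =
          (((k - j : ℕ) * (n - k - j : ℕ) : ℕ) : ℂ) := by
        rw [Nat.cast_mul, Nat.cast_sub (by omega), Nat.cast_sub (by omega),
          Nat.cast_sub (by omega)]
        ring
      rw [h1, Nat.cast_ne_zero]
      exact Nat.mul_ne_zero (by omega) (by omega)
  · intro lam hlam hp
    have hs := tt_symm n lam hlam
    rw [eval_genPoly, Finset.prod_ne_zero_iff] at hp
    have hne : ∀ j k, j < k → k ≤ n / 2 → tt (lamN n lam) j ≠ tt (lamN n lam) k := by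
      intro j k hjk hk
      have h1 := hp k (Finset.mem_range.2 (by omega))
      rw [Finset.prod_ne_zero_iff] at h1
      exact (sub_ne_zero.1 (h1 j (Finset.mem_range.2 hjk))).symm
    choose f hf using fun k : Fin ((n + 1) / 2) =>
      lift_exists n lam hn (mRel n (lamN n lam) k.1 hs)
    obtain ⟨E⟩ := abstract_iso n hn (lamN n lam) _ _ _ (gRel n lam hn) hs hne (gen_top n lam) f
      (fun k => (hf k).1) (fun k => (hf k).2.1) (fun k => (hf k).2.2)
    exact ⟨E.symm.toRingEquiv.isSemisimpleRing, ⟨E⟩⟩
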